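/- Let n, n̄ ≥ 0, and let A ∈ GL_n(ℚ) and Ā ∈ GL_n̄(ℚ) be matrices with integer entries such that A ∉ GL_n(ℤ) and Ā ∉ GL_n̄(ℤ). If G(A,ℤ^n) ≅ G(Ā,ℤ^n̄), then n = n̄, and there exists B ∈ GL_n(ℚ) such that Ā = BAB⁻¹ and ⋃_{j∈ℤ} A^j(ℤ^n) = ⋃_{j∈ℤ} A^jB⁻¹(ℤ^n). -/

import Mathlib

open Matrix

noncomputable section

/-- The coercion `ℤ^n → ℚ^n` as an additive homomorphism. -/
def ZtoQ (n : ℕ) : (Fin n → ℤ) →+ (Fin n → ℚ) :=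
  AddMonoidHom.mk' (fun v i => (v i : ℚ)) (by intro a b; funext i; simp)

/-- The image `A·L ⊆ ℚ^n` of a subgroup `L ≤ ℤ^n` under the matrix `A`. -/
def QImage {n : ℕ} (A : Matrix (Fin n) (Fin n) ℚ) (L : AddSubgroup (Fin n → ℤ)) :
    AddSubgroup (Fin n → ℚ) :=
  (L.map (ZtoQ n)).map A.mulVecLin.toAddMonoidHom

/-- The subgroup `AL` of `ℤ^n`, i.e. the set of integer vectors lying in `A·L`. -/
def ALsub {n : ℕ} (A : Matrix (Fin n) (Fin n) ℚ) (L : AddSubgroup (Fin n → ℤ)) :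
    AddSubgroup (Fin n → ℤ) :=
  (QImage A L).comap (ZtoQ n)

/-- `x^v = x_1^{v_1} ⋯ x_n^{v_n}` in the free group on `x_1,…,x_n,t`. -/
def xWord (n : ℕ) (v : Fin n → ℤ) : FreeGroup (Fin n ⊕ Unit) :=
  (List.ofFn fun i => (FreeGroup.of (Sum.inl i) : FreeGroup (Fin n ⊕ Unit)) ^ (v i)).prod

/-- The relations of the Leary–Minasyan group `G(A,L)`. -/
def LMrels (n : ℕ) (A : Matrix (Fin n) (Fin n) ℚ) (L : AddSubgroup (Fin n → ℤ)) :
    Set (FreeGroup (Fin n ⊕ Unit)) :=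
  {r | (∃ i j : Fin n,
          r = FreeGroup.of (Sum.inl i) * FreeGroup.of (Sum.inl j) *
              (FreeGroup.of (Sum.inl i))⁻¹ * (FreeGroup.of (Sum.inl j))⁻¹) ∨
       (∃ v ∈ L, ∃ w : Fin n → ℤ, ZtoQ n w = A.mulVec (ZtoQ n v) ∧
          r = FreeGroup.of (Sum.inr ()) * xWord n v * (FreeGroup.of (Sum.inr ()))⁻¹ *
              (xWord n w)⁻¹)}

/-- The Leary–Minasyan group `G(A,L)`. -/
abbrev LM (n : ℕ) (A : Matrix (Fin n) (Fin n) ℚ) (L : AddSubgroup (Fin n → ℤ)) :=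
  PresentedGroup (LMrels n A L)

/-- The generator `x_i` of `G(A,L)`. -/
def Xg (n : ℕ) (A : Matrix (Fin n) (Fin n) ℚ) (L : AddSubgroup (Fin n → ℤ)) (i : Fin n) :
    LM n A L :=
  PresentedGroup.of (Sum.inl i)

/-- The stable letter `t` of `G(A,L)`. -/
def Tg (n : ℕ) (A : Matrix (Fin n) (Fin n) ℚ) (L : AddSubgroup (Fin n → ℤ)) : LM n A L :=
  PresentedGroup.of (Sum.inr ())

/-- The element `x^v` of `G(A,L)`. -/
def Xv (n : ℕ) (A : Matrix (Fin n) (Fin n) ℚ) (L : AddSubgroup (Fin n → ℤ)) (v : Fin n → ℤ) :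
    LM n A L :=
  (List.ofFn fun i => (Xg n A L i) ^ (v i)).prod

/-- The base subgroup `H = ⟨x_1,…,x_n⟩` of `G(A,L)`. -/
def Hsub (n : ℕ) (A : Matrix (Fin n) (Fin n) ℚ) (L : AddSubgroup (Fin n → ℤ)) :
    Subgroup (LM n A L) :=
  Subgroup.closure (Set.range (Xg n A L))

/-- The set `⋃_{j∈ℤ} A^j(ℤ^n) ⊆ ℚ^n`. -/
def unionSet {n : ℕ} (A : Matrix (Fin n) (Fin n) ℚ) : Set (Fin n → ℚ) :=
  ⋃ j : ℤ, (A ^ j).mulVec '' Set.range (ZtoQ n)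

/-- Cast an integer matrix to a rational matrix. -/
def QMat {k : ℕ} (M : Matrix (Fin k) (Fin k) ℤ) : Matrix (Fin k) (Fin k) ℚ :=
  M.map (Int.cast)

/-- The block matrix `[[1, 0ᵀ],[u, C]]`. -/
def blockOne {k : ℕ} (u : Fin k → ℤ) (C : Matrix (Fin k) (Fin k) ℤ) :
    Matrix (Fin (k+1)) (Fin (k+1)) ℤ :=
  Matrix.of fun i j =>
    Fin.cases (Fin.cases 1 (fun _ => 0) j) (fun i' => Fin.cases (u i') (fun j' => C i' j') j) i

/-- Transport a subgroup of `ℤ^a` along an equality `a = b` of dimensions. -/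
def reindexSub {a b : ℕ} (h : a = b) (L : AddSubgroup (Fin a → ℤ)) :
    AddSubgroup (Fin b → ℤ) :=
  L.map (AddMonoidHom.mk' (fun v => v ∘ (finCongr h).symm) (fun _ _ => rfl))


lemma ZtoQ_apply {n : ℕ} (v : Fin n → ℤ) (i : Fin n) : ZtoQ n v i = (v i : ℚ) := rfl

lemma ZtoQ_injective (n : ℕ) : Function.Injective (ZtoQ n) := fun v w h => by
  funext i
  simpa [ZtoQ_apply] using congrFun h i

lemma ZtoQ_single {n : ℕ} (i : Fin n) : ZtoQ n (Pi.single i 1) = Pi.single i 1 := by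
  funext j
  by_cases h : j = i
  · subst h; simp [ZtoQ_apply]
  · simp [ZtoQ_apply, h]

lemma QMat_mulVec_ZtoQ {n : ℕ} (M : Matrix (Fin n) (Fin n) ℤ) (v : Fin n → ℤ) :
    QMat M *ᵥ ZtoQ n v = ZtoQ n (M *ᵥ v) := by
  funext i
  simp [QMat, ZtoQ_apply, Matrix.mulVec, dotProduct]

lemma QMat_pow {n : ℕ} (M : Matrix (Fin n) (Fin n) ℤ) (k : ℕ) : QMat (M ^ k) = QMat M ^ k :=
  map_pow (Int.castRingHom ℚ).mapMatrix M k

lemma QMat_det {n : ℕ} (M : Matrix (Fin n) (Fin n) ℤ) : (QMat M).det = (M.det : ℚ) :=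
  ((Int.castRingHom ℚ).map_det M).symm

/-- Two rational matrices agreeing on integer vectors are equal. -/
lemma matrix_ext_ZtoQ {m n : ℕ} {P Q : Matrix (Fin m) (Fin n) ℚ}
    (h : ∀ v, P *ᵥ ZtoQ n v = Q *ᵥ ZtoQ n v) : P = Q := by
  refine Matrix.ext_of_mulVec_single fun i => ?_
  simpa [ZtoQ_single] using h (Pi.single i 1)

/-- An additive map `ℤ^n → ℚ^m` is given by a rational matrix. -/
lemma exists_matrix_of_addMonoidHom {m n : ℕ} (f : (Fin n → ℤ) →+ (Fin m → ℚ)) :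
    ∃ F : Matrix (Fin m) (Fin n) ℚ, ∀ v, f v = F *ᵥ ZtoQ n v := by
  refine ⟨Matrix.of fun i j => f (Pi.single j 1) i, fun v => ?_⟩
  have hv : v = ∑ j, v j • (Pi.single j 1 : Fin n → ℤ) := by
    funext i
    simp [Finset.sum_apply, Pi.single_apply]
  conv_lhs => rw [hv]
  funext i
  simp only [map_sum, map_zsmul, Finset.sum_apply, Pi.smul_apply, Matrix.mulVec, dotProduct,
    of_apply, ZtoQ_apply]
  exact Finset.sum_congr rfl fun j _ => by rw [zsmul_eq_mul, mul_comm]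

/-- The semidirect product `ℚ^n ⋊ ℤ`, where the generator of `ℤ` acts as the matrix `A`. -/
@[ext]
structure RatSemidirect {n : ℕ} (A : (Matrix (Fin n) (Fin n) ℚ)ˣ) where
  vec : Fin n → ℚ
  deg : ℤ

namespace RatSemidirect

variable {n : ℕ} {A : (Matrix (Fin n) (Fin n) ℚ)ˣ}

instance : Mul (RatSemidirect A) :=
  ⟨fun g h => ⟨g.vec + (A ^ g.deg).val *ᵥ h.vec,
    g.deg + h.deg⟩⟩

instance : One (RatSemidirect A) := ⟨⟨0, 0⟩⟩

instance : Inv (RatSemidirect A) :=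
  ⟨fun g => ⟨-((A ^ (-g.deg)).val *ᵥ g.vec),
    -g.deg⟩⟩

@[simp] lemma mul_vec (g h : RatSemidirect A) : (g * h).vec =
    g.vec + (A ^ g.deg).val *ᵥ h.vec := rfl

@[simp] lemma mul_deg (g h : RatSemidirect A) : (g * h).deg = g.deg + h.deg := rfl

@[simp] lemma one_vec : (1 : RatSemidirect A).vec = 0 := rfl

@[simp] lemma one_deg : (1 : RatSemidirect A).deg = 0 := rfl

@[simp] lemma inv_vec (g : RatSemidirect A) : (g⁻¹).vec =
    -((A ^ (-g.deg)).val *ᵥ g.vec) := rfl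

@[simp] lemma inv_deg (g : RatSemidirect A) : (g⁻¹).deg = -g.deg := rfl

instance : Group (RatSemidirect A) :=
  Group.ofLeftAxioms
    (fun a b c => by
      ext1
      · simp only [mul_vec, mul_deg, _root_.zpow_add, Units.val_mul, mulVec_add, mulVec_mulVec, add_assoc]
      · simp [add_assoc])
    (fun a => by ext1 <;> simp)
    (fun a => by ext1 <;> simp)

/-- The projection of `ℚ^n ⋊ ℤ` onto `ℤ`. -/
def degHom (A : (Matrix (Fin n) (Fin n) ℚ)ˣ) : RatSemidirect A →* Multiplicative ℤ where
  toFun g := Multiplicative.ofAdd g.deg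
  map_one' := rfl
  map_mul' _ _ := rfl

/-- The inclusion of `ℚ^n` into `ℚ^n ⋊ ℤ`. -/
def inl (A : (Matrix (Fin n) (Fin n) ℚ)ˣ) :
    Multiplicative (Fin n → ℚ) →* RatSemidirect A where
  toFun u := ⟨u.toAdd, 0⟩
  map_one' := rfl
  map_mul' u v := by ext1 <;> simp

lemma inl_ofAdd (u : Fin n → ℚ) : inl A (Multiplicative.ofAdd u) = ⟨u, 0⟩ := rfl

@[simp] lemma zpow_deg (g : RatSemidirect A) (k : ℤ) : (g ^ k).deg = k * g.deg := by
  have := congrArg Multiplicative.toAdd (map_zpow (degHom A) g k)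
  simpa [degHom] using this

lemma stable_zpow (k : ℤ) : (⟨0, 1⟩ : RatSemidirect A) ^ k = ⟨0, k⟩ := by
  have h : ∀ m : ℕ, (⟨0, 1⟩ : RatSemidirect A) ^ m = ⟨0, m⟩ := fun m => by
    induction m with
    | zero => rfl
    | succ m ih => rw [pow_succ, ih]; ext1 <;> simp
  obtain ⟨m, rfl | rfl⟩ := k.eq_nat_or_neg
  · simpa using h m
  · rw [_root_.zpow_neg, zpow_natCast, h]; ext1 <;> simp

lemma conj_mk_zero (g : RatSemidirect A) (w : Fin n → ℚ) : g * ⟨w, 0⟩ * g⁻¹ =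
    ⟨(A ^ g.deg).val *ᵥ w, 0⟩ := by
  ext1
  · simp only [mul_vec, mul_deg, inv_vec, add_zero, mulVec_neg, mulVec_mulVec, ← Units.val_mul,
      ← _root_.zpow_add]
    simp
  · simp

end RatSemidirect

namespace LM

open scoped IsMulCommutative

variable {n : ℕ}

lemma lift_xWord (A : (Matrix (Fin n) (Fin n) ℚ)ˣ) (v : Fin n → ℤ) :
    FreeGroup.lift (Sum.elim (fun i => (⟨Pi.single i 1, 0⟩ : RatSemidirect A))
      (fun _ => ⟨0, 1⟩)) (xWord n v) = ⟨ZtoQ n v, 0⟩ := by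
  rw [xWord, map_list_prod, List.map_ofFn, ← RatSemidirect.inl_ofAdd]
  have : (fun i => (FreeGroup.lift (Sum.elim
      (fun i => (⟨Pi.single i 1, 0⟩ : RatSemidirect A)) (fun _ => ⟨0, 1⟩)))
        ((FreeGroup.of (Sum.inl i) : FreeGroup (Fin n ⊕ Unit)) ^ v i)) =
      RatSemidirect.inl A ∘ fun i =>
        (Multiplicative.ofAdd (Pi.single i 1 : Fin n → ℚ)) ^ v i := by
    funext i
    simp [RatSemidirect.inl_ofAdd]
  rw [Function.comp_def, this, ← List.map_ofFn, ← map_list_prod, List.prod_ofFn]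
  congr 1
  simp_rw [← ofAdd_zsmul]
  rw [← ofAdd_sum]
  congr 1
  funext i
  simp [Finset.sum_apply, Pi.single_apply, ZtoQ_apply]

/-- The canonical representation of `G(A,ℤ^n)` in `ℚ^n ⋊ ℤ`. -/
def toRat (A : (Matrix (Fin n) (Fin n) ℚ)ˣ) :
    LM n A.val ⊤ →* RatSemidirect A :=
  PresentedGroup.toGroup
    (f := Sum.elim (fun i => (⟨Pi.single i 1, 0⟩ : RatSemidirect A)) (fun _ => ⟨0, 1⟩)) <| by
    rintro r (⟨i, j, rfl⟩ | ⟨v, -, w, hw, rfl⟩)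
    · simp only [map_mul, map_inv, FreeGroup.lift_apply_of, Sum.elim_inl]
      rw [mul_inv_eq_one, mul_inv_eq_iff_eq_mul]
      ext1 <;> simp only [RatSemidirect.mul_vec, RatSemidirect.mul_deg, zpow_zero, Units.val_one,
        one_mulVec, add_comm]
    · rw [map_mul, map_mul, map_mul, map_inv, map_inv, lift_xWord, lift_xWord, mul_inv_eq_one]
      rw [FreeGroup.lift_apply_of, Sum.elim_inr, RatSemidirect.conj_mk_zero, hw]
      simp

lemma mk_xWord (A : Matrix (Fin n) (Fin n) ℚ) (v : Fin n → ℤ) :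
    PresentedGroup.mk (LMrels n A ⊤) (xWord n v) = Xv n A ⊤ v := by
  rw [xWord, Xv, map_list_prod, List.map_ofFn]
  rfl

lemma toRat_Xv (A : (Matrix (Fin n) (Fin n) ℚ)ˣ) (v : Fin n → ℤ) :
    toRat A (Xv n A ⊤ v) = ⟨ZtoQ n v, 0⟩ := by
  rw [← mk_xWord, ← lift_xWord]
  rfl

lemma toRat_Tg (A : (Matrix (Fin n) (Fin n) ℚ)ˣ) : toRat A (Tg n A ⊤) = ⟨0, 1⟩ :=
  PresentedGroup.toGroup.of _

lemma Xg_comm (A : Matrix (Fin n) (Fin n) ℚ) (i j : Fin n) :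
    Xg n A ⊤ i * Xg n A ⊤ j = Xg n A ⊤ j * Xg n A ⊤ i := by
  have h : PresentedGroup.mk (LMrels n A ⊤) (FreeGroup.of (Sum.inl i) * FreeGroup.of (Sum.inl j) *
      (FreeGroup.of (Sum.inl i))⁻¹ * (FreeGroup.of (Sum.inl j))⁻¹) = 1 :=
    PresentedGroup.one_of_mem (Or.inl ⟨i, j, rfl⟩)
  simp only [map_mul, map_inv] at h
  rw [mul_inv_eq_one, mul_inv_eq_iff_eq_mul] at h
  exact h

instance (A : Matrix (Fin n) (Fin n) ℚ) : IsMulCommutative (Hsub n A ⊤) :=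
  Subgroup.isMulCommutative_closure (by rintro _ ⟨i, rfl⟩ _ ⟨j, rfl⟩; exact Xg_comm A i j)

lemma Xv_eq_coe_prod (A : Matrix (Fin n) (Fin n) ℚ) (v : Fin n → ℤ) :
    Xv n A ⊤ v = (Hsub n A ⊤).subtype
      (∏ i, (⟨Xg n A ⊤ i, Subgroup.subset_closure ⟨i, rfl⟩⟩ : Hsub n A ⊤) ^ v i) := by
  rw [← List.prod_ofFn, map_list_prod, List.map_ofFn]
  rfl

lemma Xv_add (A : Matrix (Fin n) (Fin n) ℚ) (v w : Fin n → ℤ) :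
    Xv n A ⊤ (v + w) = Xv n A ⊤ v * Xv n A ⊤ w := by
  rw [Xv_eq_coe_prod, Xv_eq_coe_prod, Xv_eq_coe_prod, ← map_mul, ← Finset.prod_mul_distrib]
  simp only [Pi.add_apply, _root_.zpow_add]

/-- The homomorphism `v ↦ x^v`. -/
def XvHom (A : Matrix (Fin n) (Fin n) ℚ) : Multiplicative (Fin n → ℤ) →* LM n A ⊤ :=
  MonoidHom.mk' (fun v => Xv n A ⊤ v.toAdd) fun _ _ => Xv_add A _ _

lemma Xv_zero (A : Matrix (Fin n) (Fin n) ℚ) : Xv n A ⊤ 0 = 1 := map_one (XvHom A)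

lemma Xv_neg (A : Matrix (Fin n) (Fin n) ℚ) (v : Fin n → ℤ) :
    Xv n A ⊤ (-v) = (Xv n A ⊤ v)⁻¹ := map_inv (XvHom A) (Multiplicative.ofAdd v)

lemma Xv_single (A : Matrix (Fin n) (Fin n) ℚ) (i : Fin n) :
    Xv n A ⊤ (Pi.single i 1) = Xg n A ⊤ i := by
  rw [Xv_eq_coe_prod, Finset.prod_eq_single i]
  · simp
  · intro j _ hj
    simp [hj]
  · simp

lemma Tg_mul_Xv {A : Matrix (Fin n) (Fin n) ℚ} {M : Matrix (Fin n) (Fin n) ℤ} (hM : A = QMat M)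
    (v : Fin n → ℤ) : Tg n A ⊤ * Xv n A ⊤ v = Xv n A ⊤ (M *ᵥ v) * Tg n A ⊤ := by
  have h : PresentedGroup.mk (LMrels n A ⊤) (FreeGroup.of (Sum.inr ()) * xWord n v *
      (FreeGroup.of (Sum.inr ()))⁻¹ * (xWord n (M *ᵥ v))⁻¹) = 1 :=
    PresentedGroup.one_of_mem (Or.inr ⟨v, trivial, M *ᵥ v, by rw [hM, QMat_mulVec_ZtoQ], rfl⟩)
  simp only [map_mul, map_inv, mk_xWord] at h
  rw [mul_inv_eq_one, mul_inv_eq_iff_eq_mul] at h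
  exact h

lemma Tg_pow_mul_Xv {A : Matrix (Fin n) (Fin n) ℚ} {M : Matrix (Fin n) (Fin n) ℤ}
    (hM : A = QMat M) (a : ℕ) (v : Fin n → ℤ) :
    Tg n A ⊤ ^ a * Xv n A ⊤ v = Xv n A ⊤ (M ^ a *ᵥ v) * Tg n A ⊤ ^ a := by
  induction a with
  | zero => simp
  | succ a ih =>
    rw [pow_succ', mul_assoc, ih, ← mul_assoc, Tg_mul_Xv hM, mul_assoc, mulVec_mulVec, pow_succ' M]

/-- Every element of `G(A,ℤ^n)` has the form `t^{-a} x^v t^b` when `A` is integral. -/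
lemma exists_normal_form {A : Matrix (Fin n) (Fin n) ℚ} {M : Matrix (Fin n) (Fin n) ℤ}
    (hM : A = QMat M) (g : LM n A ⊤) :
    ∃ (a b : ℕ) (v : Fin n → ℤ), g = (Tg n A ⊤ ^ a)⁻¹ * Xv n A ⊤ v * Tg n A ⊤ ^ b := by
  have hX : ∀ (w : Fin n → ℤ) (y : LM n A ⊤),
      (∃ (a b : ℕ) (v : Fin n → ℤ), y = (Tg n A ⊤ ^ a)⁻¹ * Xv n A ⊤ v * Tg n A ⊤ ^ b) →
      ∃ (a b : ℕ) (v : Fin n → ℤ),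
        Xv n A ⊤ w * y = (Tg n A ⊤ ^ a)⁻¹ * Xv n A ⊤ v * Tg n A ⊤ ^ b := by
    rintro w _ ⟨a, b, v, rfl⟩
    refine ⟨a, b, M ^ a *ᵥ w + v, ?_⟩
    rw [Xv_add]
    have h := Tg_pow_mul_Xv hM a w
    rw [← mul_inv_eq_iff_eq_mul] at h
    rw [← h]
    group
  have hg : g ∈ Subgroup.closure (Set.range (PresentedGroup.of (rels := LMrels n A ⊤))) := by
    rw [PresentedGroup.closure_range_of]; trivial
  induction hg using Subgroup.closure_induction_left with
  | one => exact ⟨0, 0, 0, by simp [Xv_zero]⟩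
  | mul_left x hx y _ ih =>
    obtain ⟨i | ⟨⟩, rfl⟩ := hx
    · have := hX (Pi.single i 1) y ih
      rwa [Xv_single] at this
    · obtain ⟨a, b, v, rfl⟩ := ih
      rcases a with _ | a
      · refine ⟨0, b + 1, M *ᵥ v, ?_⟩
        have h := Tg_mul_Xv hM v
        simp only [pow_zero, inv_one, one_mul, pow_succ', ← mul_assoc]
        rw [← h]
        rfl
      · refine ⟨a, b, v, ?_⟩
        change Tg n A ⊤ * _ = _
        rw [pow_succ]
        group
  | inv_mul_cancel x hx y _ ih =>
    obtain ⟨i | ⟨⟩, rfl⟩ := hx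
    · have := hX (-Pi.single i 1) y ih
      rwa [Xv_neg, Xv_single] at this
    · obtain ⟨a, b, v, rfl⟩ := ih
      refine ⟨a + 1, b, v, ?_⟩
      change (Tg n A ⊤)⁻¹ * _ = _
      rw [pow_succ]
      group

lemma toRat_normal_form (A : (Matrix (Fin n) (Fin n) ℚ)ˣ) (a b : ℕ) (v : Fin n → ℤ) :
    toRat A ((Tg n A ⊤ ^ a)⁻¹ * Xv n A ⊤ v * Tg n A ⊤ ^ b) =
      ⟨(A ^ (-a : ℤ)).val *ᵥ ZtoQ n v, b - a⟩ := by
  rw [map_mul, map_mul, map_inv, map_pow, map_pow, toRat_Tg, toRat_Xv, ← zpow_natCast,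
    ← zpow_natCast, ← _root_.zpow_neg, RatSemidirect.stable_zpow, RatSemidirect.stable_zpow]
  ext1
  · simp
  · simp; ring

lemma toRat_injective {A : (Matrix (Fin n) (Fin n) ℚ)ˣ} {M : Matrix (Fin n) (Fin n) ℤ}
    (hM : A.val = QMat M) : Function.Injective (toRat A) := by
  rw [injective_iff_map_eq_one]
  intro g hg
  obtain ⟨a, b, v, rfl⟩ := exists_normal_form hM g
  rw [toRat_normal_form, RatSemidirect.ext_iff] at hg
  obtain ⟨h1, h2⟩ := hg
  have hab : a = b := by simp at h2; omega
  have hv : v = 0 := by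
    apply ZtoQ_injective
    have := congrArg (fun x =>
      (A ^ (a : ℤ)).val *ᵥ x) h1
    simpa only [mulVec_mulVec, ← Units.val_mul, ← _root_.zpow_add, add_neg_cancel, zpow_zero,
      Units.val_one, one_mulVec, RatSemidirect.one_vec, mulVec_zero, map_zero] using this
  subst hab hv
  simp [Xv_zero]

lemma toRat_vec_mem_unionSet {A : (Matrix (Fin n) (Fin n) ℚ)ˣ} {M : Matrix (Fin n) (Fin n) ℤ}
    (hM : A.val = QMat M) (g : LM n A.val ⊤) :
    (toRat A g).vec ∈ unionSet A.val := by
  obtain ⟨a, b, v, rfl⟩ := exists_normal_form hM g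
  rw [toRat_normal_form]
  exact Set.mem_iUnion.2 ⟨-a, ZtoQ n v, ⟨v, rfl⟩, by rw [Matrix.coe_units_zpow]⟩

lemma exists_toRat_eq (A : (Matrix (Fin n) (Fin n) ℚ)ˣ) {u : Fin n → ℚ}
    (hu : u ∈ unionSet A.val) : ∃ g, toRat A g = ⟨u, 0⟩ := by
  obtain ⟨j, _, ⟨v, rfl⟩, rfl⟩ := Set.mem_iUnion.1 hu
  refine ⟨Tg n A ⊤ ^ j * Xv n A ⊤ v * (Tg n A ⊤ ^ j)⁻¹, ?_⟩
  rw [map_mul, map_mul, map_inv, map_zpow, toRat_Tg, toRat_Xv, RatSemidirect.stable_zpow,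
    RatSemidirect.conj_mk_zero, Matrix.coe_units_zpow]

lemma commute_of_deg_eq_zero {A : (Matrix (Fin n) (Fin n) ℚ)ˣ} {M : Matrix (Fin n) (Fin n) ℤ}
    (hM : A.val = QMat M) {g h : LM n A.val ⊤}
    (hg : (toRat A g).deg = 0) (hh : (toRat A h).deg = 0) : g * h = h * g := by
  apply toRat_injective hM
  rw [map_mul, map_mul]
  ext1 <;> simp [hg, hh, add_comm]

variable {m : ℕ}

/-- If `g` commutes with all its commutators with `ℤ^n`, then its degree is not positive. -/
lemma deg_nonpos_of_commute {A : (Matrix (Fin n) (Fin n) ℚ)ˣ} {M : Matrix (Fin n) (Fin n) ℤ}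
    (hM : A.val = QMat M) (hdet : ¬ IsUnit M.det) (g : LM n A.val ⊤)
    (hg : ∀ w, (Xv n A ⊤ w * g * (Xv n A ⊤ w)⁻¹ * g⁻¹) * g =
      g * (Xv n A ⊤ w * g * (Xv n A ⊤ w)⁻¹ * g⁻¹)) : (toRat A g).deg ≤ 0 := by
  by_contra! hpos
  obtain ⟨k, hk⟩ := Int.eq_ofNat_of_zero_le hpos.le
  have hk0 : k ≠ 0 := by rintro rfl; simp [hk] at hpos
  refine hdet ?_
  have key : M ^ k * (2 - M ^ k) = 1 := by
    have h2 : ∀ w, (M ^ k * (2 - M ^ k)) *ᵥ w = w := fun w => by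
      have e : Xv n A ⊤ w * g * (Xv n A ⊤ w)⁻¹ * g⁻¹ =
          Xv n A ⊤ w * (g * (Xv n A ⊤ (-w)) * g⁻¹) := by rw [Xv_neg]; group
      have h1 : Xv n A ⊤ w * (g * (Xv n A ⊤ (-w)) * g⁻¹) =
          g * (Xv n A ⊤ w * (g * (Xv n A ⊤ (-w)) * g⁻¹)) * g⁻¹ := by
        rw [eq_mul_inv_iff_mul_eq, ← e]; exact hg w
      have hP : (A ^ (toRat A g).deg).val =
          QMat (M ^ k) := by
        rw [hk, zpow_natCast, Units.val_pow_eq_pow_val, hM, QMat_pow]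
      have h3 : toRat A (Xv n A ⊤ w * (g * (Xv n A ⊤ (-w)) * g⁻¹)) =
          ⟨ZtoQ n (w - M ^ k *ᵥ w), 0⟩ := by
        rw [map_mul, map_mul, map_mul, map_inv, toRat_Xv, toRat_Xv, RatSemidirect.conj_mk_zero, hP,
          QMat_mulVec_ZtoQ]
        ext1
        · simp [mulVec_neg, sub_eq_add_neg]
        · simp
      have h4 := congrArg (toRat A) h1
      rw [h3, map_mul, map_mul, map_inv, h3, RatSemidirect.conj_mk_zero, hP,
        QMat_mulVec_ZtoQ] at h4
      have h5 := ZtoQ_injective n (congrArg RatSemidirect.vec h4)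
      rw [mul_sub, sub_mulVec, ← mulVec_mulVec, ← mulVec_mulVec]
      rw [mulVec_sub] at h5
      have h6 : M ^ k *ᵥ ((2 : Matrix (Fin n) (Fin n) ℤ) *ᵥ w) = M ^ k *ᵥ w + M ^ k *ᵥ w := by
        rw [← one_add_one_eq_two, add_mulVec, one_mulVec, mulVec_add]
      rw [h6, add_sub_assoc, ← h5]
      abel
    exact Matrix.ext_of_mulVec_single fun i => by rw [h2, one_mulVec]
  have hd := congrArg Matrix.det key
  rw [det_mul, det_one, det_pow] at hd
  exact (isUnit_pow_iff hk0).1 (IsUnit.of_mul_eq_one _ hd)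

/-- Isomorphisms preserve the kernel of the projection to `ℤ`. -/
lemma deg_map_eq_zero {A : (Matrix (Fin n) (Fin n) ℚ)ˣ} {M : Matrix (Fin n) (Fin n) ℤ}
    (hM : A.val = QMat M)
    {A' : (Matrix (Fin m) (Fin m) ℚ)ˣ} {M' : Matrix (Fin m) (Fin m) ℤ}
    (hM' : A'.val = QMat M') (hdet : ¬ IsUnit M'.det)
    (φ : LM n A.val ⊤ ≃* LM m A'.val ⊤)
    {g : LM n A.val ⊤} (hg : (toRat A g).deg = 0) : (toRat A' (φ g)).deg = 0 := by
  have h : ∀ g : LM n A.val ⊤, (toRat A g).deg = 0 → (toRat A' (φ g)).deg ≤ 0 := by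
    intro g hg
    refine deg_nonpos_of_commute hM' hdet _ fun w => ?_
    obtain ⟨c, hc⟩ := φ.surjective (Xv m A' ⊤ w)
    rw [← hc]
    simp only [← map_mul, ← map_inv]
    congr 1
    exact commute_of_deg_eq_zero hM (by simp) hg
  have h1 := h g hg
  have h2 := h g⁻¹ (by simp [hg])
  simp at h2
  omega

lemma deg_map_eq_mul {A : (Matrix (Fin n) (Fin n) ℚ)ˣ} {M : Matrix (Fin n) (Fin n) ℤ}
    (hM : A.val = QMat M)
    {A' : (Matrix (Fin m) (Fin m) ℚ)ˣ} {M' : Matrix (Fin m) (Fin m) ℤ}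
    (hM' : A'.val = QMat M') (hdet : ¬ IsUnit M'.det)
    (φ : LM n A.val ⊤ ≃* LM m A'.val ⊤)
    (g : LM n A.val ⊤) :
    (toRat A' (φ g)).deg = (toRat A g).deg * (toRat A' (φ (Tg n A ⊤))).deg := by
  have h := deg_map_eq_zero hM hM' hdet φ (g := g * (Tg n A ⊤ ^ (toRat A g).deg)⁻¹)
    (by simp [toRat_Tg])
  simp only [map_mul, map_inv, map_zpow, RatSemidirect.mul_deg, RatSemidirect.inv_deg,
    RatSemidirect.zpow_deg] at h
  linarith

/-- On the kernel of the projection to `ℤ`, an isomorphism is given by a rational matrix. -/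
lemma exists_matrix_of_mulEquiv {A : (Matrix (Fin n) (Fin n) ℚ)ˣ}
    {M : Matrix (Fin n) (Fin n) ℤ} (hM : A.val = QMat M)
    {A' : (Matrix (Fin m) (Fin m) ℚ)ˣ} {M' : Matrix (Fin m) (Fin m) ℤ}
    (hM' : A'.val = QMat M') (hdet : ¬ IsUnit M'.det)
    (φ : LM n A.val ⊤ ≃* LM m A'.val ⊤) :
    ∃ F : Matrix (Fin m) (Fin n) ℚ, (∀ g, (toRat A g).deg = 0 →
        toRat A' (φ g) = ⟨F *ᵥ (toRat A g).vec, 0⟩) ∧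
      F * A.val = (A' ^ (toRat A' (φ (Tg n A ⊤))).deg).val * F := by
  have hdeg : ∀ v, (toRat A' (φ (Xv n A ⊤ v))).deg = 0 := fun v =>
    deg_map_eq_zero hM hM' hdet φ (by rw [toRat_Xv])
  obtain ⟨F, hF⟩ := exists_matrix_of_addMonoidHom
    (AddMonoidHom.mk' (fun v => (toRat A' (φ (Xv n A ⊤ v))).vec) fun v w => by
      simp [Xv_add, hdeg])
  have hFX : ∀ v, toRat A' (φ (Xv n A ⊤ v)) = ⟨F *ᵥ ZtoQ n v, 0⟩ := fun v => by
    ext1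
    · exact hF v
    · exact hdeg v
  have hFA : F * A.val = (A' ^ (toRat A' (φ (Tg n A ⊤))).deg).val * F := by
    refine matrix_ext_ZtoQ fun v => ?_
    have h := congrArg (fun x => toRat A' (φ x)) (eq_mul_inv_of_mul_eq (Tg_mul_Xv hM v).symm)
    simp only [map_mul, map_inv, hFX, RatSemidirect.conj_mk_zero] at h
    rw [← mulVec_mulVec, ← mulVec_mulVec]
    refine Eq.trans ?_ (congrArg RatSemidirect.vec h)
    rw [← QMat_mulVec_ZtoQ, ← hM]
  refine ⟨F, fun g hg => ?_, hFA⟩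
  obtain ⟨a, b, v, rfl⟩ := exists_normal_form hM g
  rw [toRat_normal_form] at hg ⊢
  have hab : a = b := by simp at hg; omega
  subst hab
  set ε := (toRat A' (φ (Tg n A ⊤))).deg
  have hpow : ∀ a : ℕ, F * A.val ^ a = ((A' ^ ε) ^ a).val * F := fun a => by
    induction a with
    | zero => simp
    | succ a ih =>
      rw [pow_succ, ← Matrix.mul_assoc, ih, Matrix.mul_assoc, hFA, ← Matrix.mul_assoc, pow_succ,
        Units.val_mul]
  have hneg : F * (A ^ (-a : ℤ)).val = (((A' ^ ε) ^ a)⁻¹).val * F := by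
    rw [_root_.zpow_neg, zpow_natCast]
    calc F * ((A ^ a)⁻¹).val
        = ((((A' ^ ε) ^ a)⁻¹).val * (((A' ^ ε) ^ a).val * F)) * ((A ^ a)⁻¹).val := by
            rw [← Matrix.mul_assoc, Units.inv_mul, Matrix.one_mul]
      _ = _ := by
            rw [← hpow, ← Units.val_pow_eq_pow_val, Matrix.mul_assoc, Matrix.mul_assoc,
              Units.mul_inv, Matrix.mul_one]
  have hconj := RatSemidirect.conj_mk_zero ((toRat A' (φ (Tg n A ⊤)) ^ a)⁻¹) (F *ᵥ ZtoQ n v)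
  rw [inv_inv, ← hFX] at hconj
  rw [map_mul, map_mul, map_mul, map_mul, map_inv, map_inv, map_pow, map_pow, hconj]
  dsimp only
  rw [mulVec_mulVec, mulVec_mulVec, hneg]
  congr 3
  rw [RatSemidirect.inv_deg, ← zpow_natCast, RatSemidirect.zpow_deg, _root_.zpow_neg, mul_comm,
    _root_.zpow_mul, zpow_natCast]

/-- The matrices attached to an isomorphism and to its inverse are inverse to each other. -/
lemma mul_eq_one_of_forall {A : (Matrix (Fin n) (Fin n) ℚ)ˣ} {A' : (Matrix (Fin m) (Fin m) ℚ)ˣ}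
    (φ : LM n A.val ⊤ ≃* LM m A'.val ⊤)
    {F : Matrix (Fin m) (Fin n) ℚ} {F' : Matrix (Fin n) (Fin m) ℚ}
    (hF : ∀ g, (toRat A g).deg = 0 → toRat A' (φ g) = ⟨F *ᵥ (toRat A g).vec, 0⟩)
    (hF' : ∀ g, (toRat A' g).deg = 0 → toRat A (φ.symm g) = ⟨F' *ᵥ (toRat A' g).vec, 0⟩) :
    F' * F = 1 := by
  refine matrix_ext_ZtoQ fun v => ?_
  have h1 := hF (Xv n A ⊤ v) (by rw [toRat_Xv])
  have h2 := hF' (φ (Xv n A ⊤ v)) (by rw [h1])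
  rw [MulEquiv.symm_apply_apply, h1, toRat_Xv] at h2
  rw [one_mulVec, ← mulVec_mulVec]
  exact (congrArg RatSemidirect.vec h2).symm

end LM

/-- **Proposition (metabelian non-polycyclic case).** Let `A, Ā` be integer matrices,
invertible over `ℚ` but not over `ℤ`.  If `G(A,ℤ^n) ≅ G(Ā,ℤ^n̄)` then `n = n̄` and
there is `B ∈ GL_n(ℚ)` with `Ā = BAB⁻¹` and `⋃_j A^j(ℤ^n) = ⋃_j A^jB⁻¹(ℤ^n)`. -/
theorem LM_metabelian_isomorphism
    (n nb : ℕ) (A : Matrix (Fin n) (Fin n) ℚ) (Ab : Matrix (Fin nb) (Fin nb) ℚ)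
    (hA : IsUnit A.det) (hAb : IsUnit Ab.det)
    (hintA : ∃ M : Matrix (Fin n) (Fin n) ℤ, A = QMat M ∧ ¬IsUnit M.det)
    (hintAb : ∃ M : Matrix (Fin nb) (Fin nb) ℤ, Ab = QMat M ∧ ¬IsUnit M.det)
    (hiso : Nonempty (LM n A ⊤ ≃* LM nb Ab ⊤)) :
    ∃ h : nb = n, ∃ B : Matrix (Fin n) (Fin n) ℚ, IsUnit B.det ∧
      Matrix.reindex (finCongr h) (finCongr h) Ab = B * A * B⁻¹ ∧
      unionSet A = ⋃ j : ℤ, (A ^ j * B⁻¹).mulVec '' Set.range (ZtoQ n) := by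
  obtain ⟨φ⟩ := hiso
  obtain ⟨M, hM, hdet⟩ := hintA
  obtain ⟨M', hM', hdet'⟩ := hintAb
  obtain ⟨A, rfl⟩ := (Matrix.isUnit_iff_isUnit_det A).2 hA
  obtain ⟨A', rfl⟩ := (Matrix.isUnit_iff_isUnit_det Ab).2 hAb
  obtain ⟨F, hF, hFA⟩ := LM.exists_matrix_of_mulEquiv hM hM' hdet' φ
  obtain ⟨F', hF', -⟩ := LM.exists_matrix_of_mulEquiv hM' hM hdet φ.symm
  have hF'F : F' * F = 1 := LM.mul_eq_one_of_forall φ hF hF'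
  have hFF' : F * F' = 1 := LM.mul_eq_one_of_forall φ.symm hF' hF
  have hn : nb = n := by
    have := Matrix.square_of_invertible F F' hFF' hF'F
    simpa using this
  subst hn
  have hFdet : IsUnit F.det := (Matrix.isUnit_iff_isUnit_det F).1 (IsUnit.of_mul_eq_one _ hFF')
  have hinv : F⁻¹ = F' := Matrix.inv_eq_right_inv hFF'
  have hε : (LM.toRat A' (φ (Tg nb A ⊤))).deg = 1 := by
    have h1 := LM.deg_map_eq_mul hM hM' hdet' φ (φ.symm (Tg nb A' ⊤))
    rw [MulEquiv.apply_symm_apply, LM.toRat_Tg] at h1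
    refine (Int.isUnit_iff.1 (IsUnit.of_mul_eq_one_right _ h1.symm)).resolve_right fun hε => ?_
    rw [hε, _root_.zpow_neg_one] at hFA
    have h2 : A'.val * (F * A.val) = F := by
      rw [hFA, ← mul_assoc, Units.mul_inv, one_mul]
    have h3 := congrArg Matrix.det h2
    rw [det_mul, det_mul, hM, hM', QMat_det, QMat_det] at h3
    have h4 : (M'.det : ℚ) * (M.det : ℚ) = 1 :=
      mul_right_cancel₀ hFdet.ne_zero (by linear_combination h3)
    exact hdet (IsUnit.of_mul_eq_one_right _ (by exact_mod_cast h4))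
  rw [hε, zpow_one] at hFA
  have hconj : F * A.val * F⁻¹ = A'.val := by
    rw [hFA, hinv, mul_assoc, hFF', mul_one]
  refine ⟨rfl, F, hFdet, by simpa using hconj.symm, ?_⟩
  have hcomm : ∀ j : ℤ, A.val ^ j * F⁻¹ = F⁻¹ * A'.val ^ j := fun j => by
    have hS : SemiconjBy F⁻¹ A'.val A.val := by
      rw [SemiconjBy, ← hconj, hinv, ← mul_assoc, ← mul_assoc, hF'F, one_mul]
    exact (Matrix.SemiconjBy.zpow_right hAb hA hS j).eq.symm
  have hunion : (⋃ j : ℤ, (A.val ^ j * F⁻¹).mulVec '' Set.range (ZtoQ nb)) =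
      F'.mulVec '' unionSet A'.val := by
    rw [unionSet, Set.image_iUnion]
    refine Set.iUnion_congr fun j => ?_
    rw [hcomm, hinv, Set.image_image]
    simp only [mulVec_mulVec]
  rw [hunion]
  ext u
  constructor
  · intro hu
    obtain ⟨g, hg⟩ := LM.exists_toRat_eq A hu
    refine ⟨F *ᵥ u, ?_, by rw [mulVec_mulVec, hF'F, one_mulVec]⟩
    have h := LM.toRat_vec_mem_unionSet hM' (φ g)
    rwa [hF g (by rw [hg]), hg] at h
  · rintro ⟨u, hu, rfl⟩
    obtain ⟨g, hg⟩ := LM.exists_toRat_eq A' hu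
    have h := LM.toRat_vec_mem_unionSet hM (φ.symm g)
    rwa [hF' g (by rw [hg]), hg] at h
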